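/- Let X and Y be finite geometric simplicial complexes in Euclidean spaces, each with at least one face of dimension ≥ 1, and let f : |X| → |Y| be a simplicial map. Set k = 2·comesh(Y)/mesh(X) and K = mesh(Y)/(2·comesh(X)). Then for every simplex σ of X of dimension ≥ 1 whose image simplex τ = f(σ) has dimension ≥ 1, every nonempty proper face ρ of τ, and every ε > 0: {x ∈ σ : f(x) ∈ N_{kε}(ρ)} ⊆ N_ε({x ∈ σ : f(x) ∈ ρ}), and N_ε({x ∈ σ : f(x) ∈ ρ}) ∩ σ ⊆ {x ∈ σ : f(x) ∈ N_{Kε}(ρ)}. -/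

import Mathlib

noncomputable section
open Metric Set

variable {E F : Type*} [NormedAddCommGroup E] [NormedSpace ℝ E]
  [NormedAddCommGroup F] [NormedSpace ℝ F]

/-- The boundary of the simplex spanned by the finite (affinely independent) set `s`:
the union of the convex hulls of the proper nonempty subsets of `s`. -/
def simplexBoundary (s : Finset E) : Set E :=
  ⋃ (t : Finset E) (_ : t ⊂ s) (_ : t.Nonempty), convexHull ℝ (t : Set E)

/-- The radius of the simplex spanned by `s`: the distance from the barycentre
(centroid of the vertices) to the boundary. -/
def simplexRad (s : Finset E) : ℝ :=
  Metric.infDist (s.centroid ℝ id) (simplexBoundary s)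

/-- The mesh of a simplicial complex: the supremum of the diameters of its simplices. -/
def mesh (X : Geometry.SimplicialComplex ℝ E) : ℝ :=
  sSup {r : ℝ | ∃ s ∈ X.faces, r = Metric.diam (convexHull ℝ (s : Set E))}

/-- The comesh of a simplicial complex: the infimum of the radii of its simplices of
dimension at least one. -/
def comesh (X : Geometry.SimplicialComplex ℝ E) : ℝ :=
  sInf {r : ℝ | ∃ s ∈ X.faces, 2 ≤ s.card ∧ r = simplexRad s}

/-- A simplicial map `f : |X| → |Y|`: continuous on `|X|`, mapping `|X|` into `|Y|`,
sending the vertex set of each face of `X` onto the vertex set of some face of `Y`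
(in particular vertices to vertices), and restricting to an affine map on each simplex. -/
def IsSimplicialMap (X : Geometry.SimplicialComplex ℝ E)
    (Y : Geometry.SimplicialComplex ℝ F) (f : E → F) : Prop :=
  ContinuousOn f X.space ∧ MapsTo f X.space Y.space ∧
  (∀ s ∈ X.faces, ∃ t ∈ Y.faces, f '' (s : Set E) = (t : Set F)) ∧
  (∀ s ∈ X.faces, ∃ A : E →ᵃ[ℝ] F, EqOn f A (convexHull ℝ (s : Set E)))

variable {s : Finset E}

lemma simplexRad_nonneg (s : Finset E) : 0 ≤ simplexRad s := infDist_nonneg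

lemma centroid_id_eq_sum (hs : s.Nonempty) :
    s.centroid ℝ id = ∑ v ∈ s, (s.card : ℝ)⁻¹ • v := by
  rw [Finset.centroid_def, Finset.affineCombination_eq_linear_combination _ _ _
    (s.sum_centroidWeights_eq_one_of_nonempty ℝ hs)]
  simp [Finset.centroidWeights_apply]

/-- Moving from the centroid in a direction given by weights of sum zero, one stays in the simplex
until some coordinate vanishes. -/
lemma simplexRad_mul_neg_weight_le (hs : 2 ≤ s.card) (b : E → ℝ) (hb : ∑ v ∈ s, b v = 0)
    {i : E} (hi : i ∈ s) :
    simplexRad s * (s.card * -b i) ≤ ‖∑ v ∈ s, b v • v‖ := by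
  classical
  have hne : s.Nonempty := ⟨i, hi⟩
  have hc : (0 : ℝ) < s.card := by exact_mod_cast hne.card_pos
  obtain ⟨j, hj, hmin⟩ := s.exists_min_image b hne
  have hr := simplexRad_nonneg s
  refine le_trans (b := simplexRad s * (s.card * -b j)) (by gcongr; exact hmin i hi) ?_
  rcases le_or_gt 0 (b j) with h0 | h0
  · refine le_trans ?_ (norm_nonneg _)
    exact mul_nonpos_of_nonneg_of_nonpos hr (by nlinarith)
  set T : ℝ := s.card * -b j with hT
  have hTpos : 0 < T := mul_pos hc (by linarith)
  set w : E → ℝ := fun v ↦ (s.card : ℝ)⁻¹ + T⁻¹ * b v with hw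
  have hwj : w j = 0 := by
    simp only [hw, hT]
    field_simp [h0.ne]
    ring
  have hw0 : ∀ v ∈ s, 0 ≤ w v := fun v hv ↦ by
    rw [← hwj]
    simp only [hw]
    gcongr
    exact hmin v hv
  have hw1 : ∑ v ∈ s, w v = 1 := by
    simp only [hw, Finset.sum_add_distrib, ← Finset.mul_sum, hb]
    simp [hc.ne']
  have hsum : ∑ v ∈ s, w v • v = s.centroid ℝ id + T⁻¹ • ∑ v ∈ s, b v • v := by
    simp only [hw, add_smul, Finset.sum_add_distrib, centroid_id_eq_sum hne, Finset.smul_sum,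
      mul_smul]
  have hmem : ∑ v ∈ s, w v • v ∈ simplexBoundary s := by
    refine mem_iUnion.2 ⟨s.erase j, mem_iUnion.2 ⟨Finset.erase_ssubset hj, mem_iUnion.2
      ⟨Finset.card_pos.1 (by rw [Finset.card_erase_of_mem hj]; omega), ?_⟩⟩⟩
    rw [Finset.mem_convexHull']
    refine ⟨w, fun v hv ↦ hw0 v (Finset.mem_of_mem_erase hv), ?_, ?_⟩
    · rw [Finset.sum_erase _ hwj, hw1]
    · rw [Finset.sum_erase _ (by rw [hwj, zero_smul])]
  have hle : simplexRad s ≤ T⁻¹ * ‖∑ v ∈ s, b v • v‖ := by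
    refine (infDist_le_dist_of_mem hmem).trans_eq ?_
    rw [hsum, dist_self_add_right, norm_smul, Real.norm_of_nonneg (by positivity)]
  rwa [inv_mul_eq_div, le_div_iff₀ hTpos] at hle

/-- The width of a simplex between complementary faces is at least twice its radius. -/
lemma two_mul_simplexRad_mul_sum_le (hs : 2 ≤ s.card) (b : E → ℝ) (hb : ∑ v ∈ s, b v = 0)
    {I : Finset E} (hI : I ⊆ s) :
    2 * simplexRad s * ∑ v ∈ I, b v ≤ ‖∑ v ∈ s, b v • v‖ := by
  classical
  have hc : (0 : ℝ) < s.card := by exact_mod_cast (by omega : 0 < s.card)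
  have hr := simplexRad_nonneg s
  set d := ‖∑ v ∈ s, b v • v‖ with hd
  have habs : ∀ v ∈ s, simplexRad s * |b v| ≤ d / s.card := fun v hv ↦ by
    rw [le_div_iff₀ hc]
    have h1 := simplexRad_mul_neg_weight_le hs b hb hv
    have h2 := simplexRad_mul_neg_weight_le hs (fun v ↦ -b v) (by simp [hb]) hv
    simp only [neg_smul, Finset.sum_neg_distrib, norm_neg, neg_neg] at h2
    rcases abs_cases (b v) with ⟨h, -⟩ | ⟨h, -⟩ <;> rw [h] <;> linarith
  have hsplit := Finset.sum_sdiff hI (f := b)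
  have h1 : 2 * ∑ v ∈ I, b v ≤ ∑ v ∈ s, |b v| := by
    rw [← Finset.sum_sdiff hI (f := fun v ↦ |b v|)]
    have h2 : ∑ v ∈ I, b v ≤ ∑ v ∈ I, |b v| := Finset.sum_le_sum fun v _ ↦ le_abs_self _
    have h3 : -∑ v ∈ s \ I, b v ≤ ∑ v ∈ s \ I, |b v| := by
      rw [← Finset.sum_neg_distrib]
      exact Finset.sum_le_sum fun v _ ↦ neg_le_abs _
    linarith
  calc 2 * simplexRad s * ∑ v ∈ I, b v = simplexRad s * (2 * ∑ v ∈ I, b v) := by ring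
    _ ≤ simplexRad s * ∑ v ∈ s, |b v| := by gcongr
    _ = ∑ v ∈ s, simplexRad s * |b v| := Finset.mul_sum _ _ _
    _ ≤ ∑ v ∈ s, d / s.card := Finset.sum_le_sum habs
    _ = d := by rw [Finset.sum_const, nsmul_eq_mul]; field_simp

lemma simplexRad_pos (hs : 2 ≤ s.card) (hind : AffineIndependent ℝ ((↑) : s → E)) :
    0 < simplexRad s := by
  classical
  have hne : s.Nonempty := Finset.card_pos.1 (by omega)
  have hc : (0 : ℝ) < s.card := by exact_mod_cast hne.card_pos
  have hclosed : IsClosed (simplexBoundary s) := by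
    have heq : simplexBoundary s =
        ⋃ t ∈ {t : Finset E | t ⊂ s ∧ t.Nonempty}, convexHull ℝ (t : Set E) := by
      ext x; simp only [simplexBoundary, mem_iUnion, mem_ofPred_eq, exists_prop, and_assoc]
    rw [heq]
    refine Set.Finite.isClosed_biUnion ?_ fun t _ ↦
      (t.finite_toSet.isCompact_convexHull ℝ).isClosed
    exact s.powerset.finite_toSet.subset fun t ht ↦ by simpa using ht.1.subset
  have hnonempty : (simplexBoundary s).Nonempty := by
    obtain ⟨v, hv⟩ := hne
    refine ⟨v, mem_iUnion.2 ⟨{v}, mem_iUnion.2 ⟨?_, mem_iUnion.2 ⟨by simp, by simp⟩⟩⟩⟩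
    refine (Finset.singleton_subset_iff.2 hv).ssubset_of_ne fun h ↦ ?_
    rw [← h] at hs
    simp at hs
  refine (hclosed.notMem_iff_infDist_pos hnonempty).1 fun hmem ↦ ?_
  simp only [simplexBoundary, mem_iUnion] at hmem
  obtain ⟨t, hts, -, hx⟩ := hmem
  obtain ⟨w, -, hw1, hwx⟩ := Finset.mem_convexHull'.1 hx
  obtain ⟨j, hj, hjt⟩ := Finset.exists_of_ssubset hts
  set b : E → ℝ := fun v ↦ (s.card : ℝ)⁻¹ - if v ∈ t then w v else 0 with hb
  have hfilter : s.filter (· ∈ t) = t := by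
    ext v; simpa using fun h ↦ hts.subset h
  have hb0 : ∑ v ∈ s, b v = 0 := by
    simp only [hb, Finset.sum_sub_distrib, ← Finset.sum_filter, hfilter, hw1]
    simp [hc.ne']
  have hbv : ∑ v ∈ s, b v • v = 0 := by
    simp only [hb, sub_smul, ite_smul, zero_smul, Finset.sum_sub_distrib, ← Finset.sum_filter,
      hfilter, hwx]
    rw [centroid_id_eq_sum hne, sub_self]
  have hzero := affineIndependent_iff.1 hind Finset.univ (fun v ↦ b v)
    (by rw [← hb0]; exact Finset.sum_coe_sort s b)
    (by rw [← hbv]; exact Finset.sum_coe_sort s fun v ↦ b v • v) ⟨j, hj⟩ (Finset.mem_univ _)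
  simp [hb, hjt, hne.ne_empty] at hzero

lemma comesh_le {X : Geometry.SimplicialComplex ℝ E} (hs : s ∈ X.faces) (hc : 2 ≤ s.card) :
    comesh X ≤ simplexRad s := by
  refine csInf_le ⟨0, ?_⟩ ⟨s, hs, hc, rfl⟩
  rintro _ ⟨t, -, -, rfl⟩
  exact simplexRad_nonneg t

lemma comesh_pos {X : Geometry.SimplicialComplex ℝ E} (hX : X.faces.Finite)
    (hdim : ∃ s ∈ X.faces, 2 ≤ s.card) : 0 < comesh X := by
  have hfin : {r : ℝ | ∃ s ∈ X.faces, 2 ≤ s.card ∧ r = simplexRad s}.Finite := by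
    refine (hX.image simplexRad).subset ?_
    rintro _ ⟨s, hs, -, rfl⟩
    exact mem_image_of_mem _ hs
  obtain ⟨s, hs, hc⟩ := hdim
  have hne : {r : ℝ | ∃ s ∈ X.faces, 2 ≤ s.card ∧ r = simplexRad s}.Nonempty :=
    ⟨simplexRad s, s, hs, hc, rfl⟩
  obtain ⟨t, ht, htc, h⟩ := hne.csInf_mem hfin
  rw [comesh, h]
  exact simplexRad_pos htc (X.indep ht)

lemma dist_le_mesh {X : Geometry.SimplicialComplex ℝ E} (hX : X.faces.Finite)
    (hs : s ∈ X.faces) {u v : E} (hu : u ∈ s) (hv : v ∈ s) : dist u v ≤ mesh X := by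
  have hfin : {r : ℝ | ∃ s ∈ X.faces, r = Metric.diam (convexHull ℝ (s : Set E))}.Finite := by
    refine (hX.image fun s : Finset E ↦ Metric.diam (convexHull ℝ (s : Set E))).subset ?_
    rintro _ ⟨s, hs, rfl⟩
    exact mem_image_of_mem _ hs
  refine le_trans ?_ (le_csSup hfin.bddAbove ⟨s, hs, rfl⟩)
  exact dist_le_diam_of_mem (isBounded_convexHull.2 s.finite_toSet.isBounded)
    (subset_convexHull ℝ _ hu) (subset_convexHull ℝ _ hv)

lemma mesh_pos {X : Geometry.SimplicialComplex ℝ E} (hX : X.faces.Finite)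
    (hs : s ∈ X.faces) (hc : 2 ≤ s.card) : 0 < mesh X := by
  obtain ⟨u, hu, v, hv, huv⟩ := Finset.one_lt_card.1 hc
  exact (dist_pos.2 huv).trans_le (dist_le_mesh hX hs hu hv)

/-- The total weight that a convex combination of vertices puts on those mapped outside `ρ` is
controlled by the distance of its image to any point of the face spanned by `ρ`. -/
lemma two_mul_simplexRad_mul_sum_le_dist {ι : Type*} {s : Finset ι}
    {t ρ : Finset F} (ht : 2 ≤ t.card) (hρ : ρ ⊆ t)
    {g : ι → F} (hg : ∀ v ∈ s, g v ∈ t) {I : Finset ι} (hI : ∀ v, v ∈ I ↔ v ∈ s ∧ g v ∉ ρ)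
    {w : ι → ℝ} (hw : ∑ v ∈ s, w v = 1) {z : F} (hz : z ∈ convexHull ℝ (ρ : Set F)) :
    2 * simplexRad t * ∑ v ∈ I, w v ≤ dist (∑ v ∈ s, w v • g v) z := by
  classical
  obtain ⟨c, -, hc1, hcz⟩ := Finset.mem_convexHull'.1 hz
  set b : F → ℝ := fun y ↦ (∑ v ∈ s with g v = y, w v) - if y ∈ ρ then c y else 0 with hb
  have hfilter : t.filter (· ∈ ρ) = ρ := by
    ext v; simpa using fun h ↦ hρ h
  have hb0 : ∑ y ∈ t, b y = 0 := by
    simp only [hb, Finset.sum_sub_distrib, ← Finset.sum_filter, hfilter, hc1]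
    rw [Finset.sum_fiberwise_of_maps_to hg, hw, sub_self]
  have hbv : ∑ y ∈ t, b y • y = ∑ v ∈ s, w v • g v - z := by
    simp only [hb, sub_smul, ite_smul, zero_smul, Finset.sum_sub_distrib, ← Finset.sum_filter,
      hfilter, hcz]
    rw [← Finset.sum_fiberwise_of_maps_to hg]
    congr 1
    refine Finset.sum_congr rfl fun y _ ↦ ?_
    rw [Finset.sum_smul]
    exact Finset.sum_congr rfl fun v hv ↦ by rw [(Finset.mem_filter.1 hv).2]
  have hbI : ∑ y ∈ t \ ρ, b y = ∑ v ∈ I, w v := by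
    rw [← Finset.sum_fiberwise_of_maps_to (t := t \ ρ) (g := g) (s := I)
      fun v hv ↦ Finset.mem_sdiff.2 ⟨hg v ((hI v).1 hv).1, ((hI v).1 hv).2⟩]
    refine Finset.sum_congr rfl fun y hy ↦ ?_
    have hyρ := (Finset.mem_sdiff.1 hy).2
    simp only [hb, if_neg hyρ, sub_zero]
    refine Finset.sum_congr ?_ fun _ _ ↦ rfl
    ext v
    simp only [Finset.mem_filter, hI]
    constructor
    · rintro ⟨h, rfl⟩
      exact ⟨⟨h, hyρ⟩, rfl⟩
    · rintro ⟨⟨h, -⟩, h'⟩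
      exact ⟨h, h'⟩
  have := two_mul_simplexRad_mul_sum_le ht b hb0 (Finset.sdiff_subset (s := t) (t := ρ))
  rwa [hbI, hbv, ← dist_eq_norm] at this

/-- Transferring the weight carried by `I` to a vertex `v₀` outside `I` moves the convex
combination by at most that weight times the diameter. -/
lemma exists_weights_dist_le {ι : Type*} {s : Finset ι}
    {I : Finset ι} (hI : I ⊆ s) {v₀ : ι} (hv₀ : v₀ ∈ s) (hv₀I : v₀ ∉ I)
    {w : ι → ℝ} (hw0 : ∀ v ∈ s, 0 ≤ w v) (hw1 : ∑ v ∈ s, w v = 1) {g : ι → F} {D : ℝ}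
    (hD : ∀ v ∈ s, dist (g v) (g v₀) ≤ D) :
    ∃ w' : ι → ℝ, (∀ v ∈ s, 0 ≤ w' v) ∧ ∑ v ∈ s, w' v = 1 ∧ (∀ v ∈ I, w' v = 0) ∧
      dist (∑ v ∈ s, w v • g v) (∑ v ∈ s, w' v • g v) ≤ (∑ v ∈ I, w v) * D := by
  classical
  have hL : 0 ≤ ∑ v ∈ I, w v := Finset.sum_nonneg fun v hv ↦ hw0 v (hI hv)
  refine ⟨fun v ↦ w v - (if v ∈ I then w v else 0) + (if v = v₀ then ∑ v ∈ I, w v else 0),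
    fun v hv ↦ ?_, ?_, fun v hv ↦ ?_, ?_⟩
  · refine add_nonneg ?_ (by split_ifs <;> simp [hL])
    split_ifs
    · simp
    · simpa using hw0 v hv
  · simp [Finset.sum_add_distrib, hw1, hv₀, Finset.inter_eq_right.2 hI]
  · have : v ≠ v₀ := fun h ↦ hv₀I (h ▸ hv)
    simp [hv, this]
  · have heq : ∑ v ∈ s, w v • g v - ∑ v ∈ s, (w v - (if v ∈ I then w v else 0) +
        (if v = v₀ then ∑ v ∈ I, w v else 0)) • g v = ∑ v ∈ I, w v • (g v - g v₀) := by
      simp only [add_smul, sub_smul, ite_smul, zero_smul, smul_sub, Finset.sum_add_distrib,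
        Finset.sum_sub_distrib, Finset.sum_ite_mem, Finset.inter_eq_right.2 hI,
        Finset.sum_ite_eq', hv₀, if_true, Finset.sum_smul]
      abel
    rw [dist_eq_norm, heq, Finset.sum_mul]
    refine norm_sum_le_of_le _ fun v hv ↦ ?_
    rw [norm_smul, Real.norm_of_nonneg (hw0 v (hI hv)), ← dist_eq_norm]
    exact mul_le_mul_of_nonneg_left (hD v (hI hv)) (hw0 v (hI hv))

lemma sum_smul_mem_convexHull_of_eq_zero {ι : Type*} {s : Finset ι}
    {g : ι → F} {ρ : Finset F} {I : Finset ι}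
    (hI : ∀ v, v ∈ I ↔ v ∈ s ∧ g v ∉ ρ) {w : ι → ℝ} (hw0 : ∀ v ∈ s, 0 ≤ w v)
    (hw1 : ∑ v ∈ s, w v = 1) (hwI : ∀ v ∈ I, w v = 0) :
    ∑ v ∈ s, w v • g v ∈ convexHull ℝ (ρ : Set F) := by
  classical
  have hzero : ∀ v ∈ s, v ∉ s.filter (g · ∈ ρ) → w v = 0 := fun v hv hv' ↦
    hwI v ((hI v).2 ⟨hv, fun h ↦ hv' (Finset.mem_filter.2 ⟨hv, h⟩)⟩)
  rw [← Finset.sum_subset (Finset.filter_subset (g · ∈ ρ) s) hzero] at hw1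
  rw [← Finset.sum_subset (Finset.filter_subset (g · ∈ ρ) s)
    fun v hv hv' ↦ by rw [hzero v hv hv', zero_smul]]
  exact (convex_convexHull ℝ _).sum_mem (fun v hv ↦ hw0 v (Finset.mem_filter.1 hv).1) hw1
    fun v hv ↦ subset_convexHull ℝ _ (Finset.mem_filter.1 hv).2

lemma IsSimplicialMap.map_sum_smul {X : Geometry.SimplicialComplex ℝ E}
    {Y : Geometry.SimplicialComplex ℝ F} {f : E → F} (hf : IsSimplicialMap X Y f)
    (hs : s ∈ X.faces) {w : E → ℝ} (hw0 : ∀ v ∈ s, 0 ≤ w v) (hw1 : ∑ v ∈ s, w v = 1) :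
    f (∑ v ∈ s, w v • v) = ∑ v ∈ s, w v • f v := by
  obtain ⟨A, hA⟩ := hf.2.2.2 s hs
  rw [hA (Finset.mem_convexHull'.2 ⟨w, hw0, hw1, rfl⟩),
    ← Finset.affineCombination_eq_linear_combination s (fun v ↦ v) w hw1,
    Finset.map_affineCombination _ _ _ hw1,
    Finset.affineCombination_eq_linear_combination _ _ _ hw1]
  exact Finset.sum_congr rfl fun v hv ↦ by rw [hA (subset_convexHull ℝ _ hv), Function.comp_apply]


/-- Corollary to Lemma 1 of the paper: for a simplicial map `f : |X| → |Y|`,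
preimages within a simplex `σ` of a face `ρ` of the image simplex `τ = f(σ)` almost
commute with `ε`-neighbourhoods, with constants `k = 2 comesh(Y)/mesh(X)` and
`K = mesh(Y)/(2 comesh(X))`. -/
theorem preimage_neighbourhood_of_face_complex {N M : ℕ}
    (X : Geometry.SimplicialComplex ℝ (EuclideanSpace ℝ (Fin N)))
    (Y : Geometry.SimplicialComplex ℝ (EuclideanSpace ℝ (Fin M)))
    (hXfin : X.faces.Finite) (hYfin : Y.faces.Finite)
    (hXdim : ∃ s ∈ X.faces, 2 ≤ s.card) (hYdim : ∃ t ∈ Y.faces, 2 ≤ t.card)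
    (f : EuclideanSpace ℝ (Fin N) → EuclideanSpace ℝ (Fin M))
    (hf : IsSimplicialMap X Y f) :
    ∀ s ∈ X.faces, 2 ≤ s.card →
    ∀ t ∈ Y.faces, f '' (s : Set (EuclideanSpace ℝ (Fin N))) = (t : Set (EuclideanSpace ℝ (Fin M))) →
      2 ≤ t.card →
    ∀ ρ : Finset (EuclideanSpace ℝ (Fin M)), ρ ⊂ t → ρ.Nonempty →
    ∀ ε : ℝ, 0 < ε →
      ({x ∈ convexHull ℝ (s : Set (EuclideanSpace ℝ (Fin N))) |
          f x ∈ thickening (2 * comesh Y / mesh X * ε)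
            (convexHull ℝ (ρ : Set (EuclideanSpace ℝ (Fin M))))} ⊆
        thickening ε {x ∈ convexHull ℝ (s : Set (EuclideanSpace ℝ (Fin N))) |
          f x ∈ convexHull ℝ (ρ : Set (EuclideanSpace ℝ (Fin M)))}) ∧
      (thickening ε {x ∈ convexHull ℝ (s : Set (EuclideanSpace ℝ (Fin N))) |
          f x ∈ convexHull ℝ (ρ : Set (EuclideanSpace ℝ (Fin M)))} ∩
          convexHull ℝ (s : Set (EuclideanSpace ℝ (Fin N))) ⊆
        {x ∈ convexHull ℝ (s : Set (EuclideanSpace ℝ (Fin N))) |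
          f x ∈ thickening (mesh Y / (2 * comesh X) * ε)
            (convexHull ℝ (ρ : Set (EuclideanSpace ℝ (Fin M))))}) := by
  classical
  intro s hs hsc t ht hst htc ρ hρt hρ ε hε
  set I := s.filter (f · ∉ ρ)
  have hI : ∀ v, v ∈ I ↔ v ∈ s ∧ f v ∉ ρ := fun v ↦ Finset.mem_filter
  have hIs : I ⊆ s := Finset.filter_subset _ _
  have hft : ∀ v ∈ s, f v ∈ t := fun v hv ↦ by
    rw [← Finset.mem_coe, ← hst]
    exact mem_image_of_mem f hv
  obtain ⟨y₀, hy₀⟩ := hρ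
  obtain ⟨v₀, hv₀, rfl⟩ : y₀ ∈ f '' (s : Set _) := hst ▸ hρt.subset hy₀
  have hv₀I : v₀ ∉ I := fun h ↦ ((hI v₀).1 h).2 hy₀
  have hmX := mesh_pos hXfin hs hsc
  have hmY := mesh_pos hYfin ht htc
  have hcX := comesh_pos hXfin hXdim
  have hcY := comesh_pos hYfin hYdim
  have hrX := comesh_le hs hsc
  have hrY := comesh_le ht htc
  constructor
  · rintro x ⟨hx, hfx⟩
    obtain ⟨w, hw0, hw1, rfl⟩ := Finset.mem_convexHull'.1 hx
    obtain ⟨z, hz, hdz⟩ := mem_thickening_iff.1 hfx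
    rw [hf.map_sum_smul hs hw0 hw1] at hdz
    have hL : 0 ≤ ∑ v ∈ I, w v := Finset.sum_nonneg fun v hv ↦ hw0 v (hIs hv)
    have hgap := two_mul_simplexRad_mul_sum_le_dist htc hρt.subset hft hI hw1 hz
    obtain ⟨w', hw'0, hw'1, hw'I, hd⟩ := exists_weights_dist_le hIs hv₀ hv₀I hw0 hw1
      (g := fun v ↦ v) fun v hv ↦ dist_le_mesh hXfin hs hv hv₀
    refine mem_thickening_iff.2 ⟨∑ v ∈ s, w' v • v,
      ⟨Finset.mem_convexHull'.2 ⟨w', hw'0, hw'1, rfl⟩, ?_⟩, hd.trans_lt ?_⟩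
    · rw [hf.map_sum_smul hs hw'0 hw'1]
      exact sum_smul_mem_convexHull_of_eq_zero hI hw'0 hw'1 hw'I
    · have h : 2 * comesh Y * ∑ v ∈ I, w v < 2 * comesh Y / mesh X * ε :=
        lt_of_le_of_lt (by gcongr) (hgap.trans_lt hdz)
      rw [div_mul_eq_mul_div, lt_div_iff₀ hmX, mul_assoc] at h
      exact lt_of_mul_lt_mul_left h (by positivity)
  · rintro x ⟨hxt, hx⟩
    refine ⟨hx, ?_⟩
    obtain ⟨x', ⟨hx', hfx'⟩, hdx⟩ := mem_thickening_iff.1 hxt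
    obtain ⟨w, hw0, hw1, rfl⟩ := Finset.mem_convexHull'.1 hx
    obtain ⟨c, hc0, hc1, rfl⟩ := Finset.mem_convexHull'.1 hx'
    have hcI : ∑ v ∈ I, c v ≤ 0 := by
      have h := two_mul_simplexRad_mul_sum_le_dist htc hρt.subset hft hI hc1 hfx'
      rw [hf.map_sum_smul hs hc0 hc1, dist_self] at h
      exact nonpos_of_mul_nonpos_right h (by linarith)
    have hL : 0 ≤ ∑ v ∈ I, w v := Finset.sum_nonneg fun v hv ↦ hw0 v (hIs hv)
    have hgap := two_mul_simplexRad_mul_sum_le hsc (fun v ↦ w v - c v)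
      (by rw [Finset.sum_sub_distrib, hw1, hc1, sub_self]) hIs
    simp only [sub_smul, Finset.sum_sub_distrib, ← dist_eq_norm] at hgap
    obtain ⟨w', hw'0, hw'1, hw'I, hd⟩ := exists_weights_dist_le hIs hv₀ hv₀I hw0 hw1
      (g := f) fun v hv ↦ dist_le_mesh hYfin ht (hft v hv) (hft v₀ hv₀)
    refine mem_thickening_iff.2 ⟨∑ v ∈ s, w' v • f v,
      sum_smul_mem_convexHull_of_eq_zero hI hw'0 hw'1 hw'I, ?_⟩
    rw [hf.map_sum_smul hs hw0 hw1]
    refine hd.trans_lt ?_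
    have h : 2 * comesh X * ∑ v ∈ I, w v < ε := by
      refine lt_of_le_of_lt ?_ (hgap.trans_lt hdx)
      gcongr
      · linarith
      · exact (le_sub_self_iff _).2 hcI
    rw [div_mul_eq_mul_div, lt_div_iff₀ (by positivity)]
    nlinarith
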